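/- arXiv:2201.07325 — 4 statements merged into one kernel-verified Lean document; each statement's English description precedes it below -/
import Mathlib

section
/- Let Q, P, γ, R, S be finite types. Suppose given matrices A_Q ∈ Matrix Q (R ⊕ S) ℂ, K_γ ∈ Matrix γ (R ⊕ S) ℂ, K_P ∈ Matrix P (R ⊕ S) ℂ, M ∈ Matrix P γ ℂ, T ∈ Matrix S R ℂ, and diagonal matrices D ∈ Matrix (R ⊕ S) (R ⊕ S) ℂ and D_P ∈ Matrix P P ℂ. Assume: (i) the proxy identity K_P = M·K_γ; and (ii) the exact column interpolative decomposition: the R-column block of A_Q equals the S-column block of A_Q times T, and the R-column block of K_γ·D equals the S-column block of K_γ·D times T. Then the stacked matrix A_F ∈ Matrix (Q ⊕ P) (R ⊕ S) ℂ, whose Q-row block is A_Q and whose P-row block is D_P·K_P·D, satisfies the same exact column interpolative decomposition: the R-column block of A_F equals the S-column block of A_F times T. -/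
open Matrix

/-- An exact column interpolative decomposition is preserved by left multiplication. -/
theorem submatrix_inl_eq_mul_of_mul_left {α m n R S : Type*} [NonUnitalSemiring α]
    [Fintype n] [Fintype S] (B : Matrix m n α) {A : Matrix n (R ⊕ S) α} {T : Matrix S R α}
    (h : A.submatrix id Sum.inl = A.submatrix id Sum.inr * T) :
    (B * A).submatrix id Sum.inl = (B * A).submatrix id Sum.inr * T := by
  change B * A.submatrix id Sum.inl = B * A.submatrix id Sum.inr * T
  rw [h, Matrix.mul_assoc]

/-- **outgoing proxy skeletonization.** If `K_P = M·K_γ` (the proxy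
identity) and the exact column interpolative decomposition with interpolation
matrix `T` holds both for `A_Q` and for `K_γ·D`, then the stacked far-field
matrix `A_F` with row blocks `A_Q` and `D_P·K_P·D` satisfies the same exact
column interpolative decomposition. -/
theorem proxy_outgoing_skeletonization
    {Q P γ R S : Type*} [Fintype Q] [Fintype P] [Fintype γ] [Fintype R] [Fintype S]
    (A_Q : Matrix Q (R ⊕ S) ℂ) (K_γ : Matrix γ (R ⊕ S) ℂ) (K_P : Matrix P (R ⊕ S) ℂ)
    (M : Matrix P γ ℂ) (T : Matrix S R ℂ)
    (D : Matrix (R ⊕ S) (R ⊕ S) ℂ) (D_P : Matrix P P ℂ)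
    (hD : D.IsDiag) (hD_P : D_P.IsDiag)
    (hproxy : K_P = M * K_γ)
    (hAQ : A_Q.submatrix id Sum.inl = A_Q.submatrix id Sum.inr * T)
    (hKγ : (K_γ * D).submatrix id Sum.inl = (K_γ * D).submatrix id Sum.inr * T)
    (A_F : Matrix (Q ⊕ P) (R ⊕ S) ℂ)
    (hAF : A_F = fromRows A_Q (D_P * K_P * D)) :
    A_F.submatrix id Sum.inl = A_F.submatrix id Sum.inr * T := by
  have hblock : D_P * K_P * D = D_P * M * (K_γ * D) := by
    simp only [hproxy, Matrix.mul_assoc]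
  have hP := submatrix_inl_eq_mul_of_mul_left (D_P * M) hKγ
  rw [hAF, hblock]
  ext (q | p) r
  · exact congrFun₂ hAQ q r
  · exact congrFun₂ hP p r
end

section
/- Let k ∈ ℝ and y ∈ EuclideanSpace ℝ (Fin 3), and define u : EuclideanSpace ℝ (Fin 3) → ℂ by u(x) = exp(i k ‖x − y‖) / (4π ‖x − y‖), i.e. u(x) = G_k(x). Then for every x ≠ y, the Helmholtz equation holds: Δu(x) + k² u(x) = 0. -/
open Real Filter
open scoped RealInnerProductSpace

/-- The Laplacian of a function `u : EuclideanSpace ℝ (Fin 3) → ℂ`: the sum of its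
second partial derivatives along the standard coordinate directions. -/
noncomputable def laplacian (u : EuclideanSpace ℝ (Fin 3) → ℂ)
    (x : EuclideanSpace ℝ (Fin 3)) : ℂ :=
  ∑ i : Fin 3,
    fderiv ℝ (fun z => fderiv ℝ u z (EuclideanSpace.single i (1 : ℝ))) x
      (EuclideanSpace.single i (1 : ℝ))

/-- The derivative of the distance to `y`, away from `y`. -/
theorem hasFDerivAt_norm_sub_const {E : Type*} [NormedAddCommGroup E] [InnerProductSpace ℝ E]
    {x y : E} (h : x ≠ y) :
    HasFDerivAt (fun z => ‖z - y‖) (‖x - y‖⁻¹ • innerSL ℝ (x - y)) x := by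
  have hpos : 0 < ‖x - y‖ := norm_pos_iff.mpr (sub_ne_zero.mpr h)
  have hsq : HasFDerivAt (fun z => ‖z - y‖ ^ 2) _ x := ((hasFDerivAt_id x).sub_const y).norm_sq
  have hsqrt := hsq.sqrt (by positivity)
  simp only [Real.sqrt_sq (norm_nonneg _)] at hsqrt
  refine hsqrt.congr_fderiv ?_
  ext v
  simp
  field_simp

/-- The directional derivative of a radial function `z ↦ f ‖z - y‖`, away from `y`. -/
theorem HasDerivAt.fderiv_comp_norm_sub {E F : Type*} [NormedAddCommGroup E]
    [InnerProductSpace ℝ E] [NormedAddCommGroup F] [NormedSpace ℝ F] {f : ℝ → F} {f' : F}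
    {x y : E} (h : x ≠ y) (hf : HasDerivAt f f' ‖x - y‖) (v : E) :
    fderiv ℝ (fun z => f ‖z - y‖) x v = (‖x - y‖⁻¹ * ⟪x - y, v⟫) • f' := by
  have hcomp : HasFDerivAt (fun z => f ‖z - y‖) _ x :=
    hf.hasFDerivAt.comp x (hasFDerivAt_norm_sub_const h)
  rw [hcomp.fderiv]
  simp [smul_smul, inner_sub_left, mul_sub, sub_smul, smul_sub]

/-- The Laplacian of a radial function `z ↦ f ‖z - y‖` in three dimensions is
`f'' + (2 / r) f'`. -/
theorem laplacian_comp_norm_sub {f f' : ℝ → ℂ} {f'' : ℂ} {x y : EuclideanSpace ℝ (Fin 3)}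
    (h : x ≠ y) (hf : ∀ r, 0 < r → HasDerivAt f (f' r) r)
    (hf' : HasDerivAt f' f'' ‖x - y‖) :
    laplacian (fun z => f ‖z - y‖) x = f'' + 2 / (‖x - y‖ : ℂ) * f' ‖x - y‖ := by
  have hpos : 0 < ‖x - y‖ := norm_pos_iff.mpr (sub_ne_zero.mpr h)
  have hne : (‖x - y‖ : ℂ) ≠ 0 := by exact_mod_cast hpos.ne'
  have hterm (i : Fin 3) :
      fderiv ℝ (fun z => fderiv ℝ (fun z => f ‖z - y‖) z (EuclideanSpace.single i (1 : ℝ))) x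
        (EuclideanSpace.single i (1 : ℝ)) =
      (f'' / (‖x - y‖ : ℂ) ^ 2 - f' ‖x - y‖ / (‖x - y‖ : ℂ) ^ 3) * ((x i - y i : ℝ) : ℂ) ^ 2
        + f' ‖x - y‖ / (‖x - y‖ : ℂ) := by
    have heq : (fun z => fderiv ℝ (fun z => f ‖z - y‖) z (EuclideanSpace.single i (1 : ℝ)))
        =ᶠ[nhds x] fun z =>
          ⟪z - y, EuclideanSpace.single i (1 : ℝ)⟫ • (‖z - y‖⁻¹ • f' ‖z - y‖) := by
      filter_upwards [isOpen_ne.mem_nhds h] with z hz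
      rw [(hf _ (norm_pos_iff.mpr (sub_ne_zero.mpr hz))).fderiv_comp_norm_sub hz, mul_comm,
        mul_smul]
    have hg : HasDerivAt (fun r : ℝ => r⁻¹ • f' r) _ ‖x - y‖ :=
      (hasDerivAt_inv hpos.ne').smul hf'
    have hgr : HasFDerivAt (fun z => ‖z - y‖⁻¹ • f' ‖z - y‖) _ x :=
      HasFDerivAt.comp (g := fun r : ℝ => r⁻¹ • f' r) x hg.hasFDerivAt
        (hasFDerivAt_norm_sub_const h)
    have hl : HasFDerivAt (fun z => ⟪z - y, EuclideanSpace.single i (1 : ℝ)⟫) _ x :=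
      ((hasFDerivAt_id x).sub_const y).inner ℝ
        (hasFDerivAt_const (EuclideanSpace.single i (1 : ℝ)) x)
    rw [heq.fderiv_eq, (hl.fun_smul hgr).fderiv]
    simp [EuclideanSpace.inner_single_right]
    field_simp
    ring
  have hsum : (‖x - y‖ : ℂ) ^ 2 = ∑ i, ((x i - y i : ℝ) : ℂ) ^ 2 := by
    have := EuclideanSpace.real_norm_sq_eq (x - y)
    simp only [PiLp.sub_apply] at this
    exact_mod_cast this
  simp only [laplacian, hterm, Finset.sum_add_distrib, ← Finset.mul_sum, ← hsum]
  simp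
  field_simp
  ring

/-- The Helmholtz free-space Green's function
`G_k(x) = exp(i k ‖x − y‖)/(4π ‖x − y‖)` with source `y` satisfies the Helmholtz
equation `Δu + k²u = 0` away from the source. -/
theorem helmholtz_green_function_satisfies_helmholtz
    (k : ℝ) (y : EuclideanSpace ℝ (Fin 3))
    (u : EuclideanSpace ℝ (Fin 3) → ℂ)
    (hu : ∀ x, u x =
      Complex.exp (Complex.I * (k : ℂ) * (‖x - y‖ : ℂ)) / (4 * (π : ℂ) * (‖x - y‖ : ℂ))) :
    ∀ x, x ≠ y → laplacian u x + (k : ℂ) ^ 2 * u x = 0 := by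
  intro x hx
  have hne : (‖x - y‖ : ℂ) ≠ 0 := by exact_mod_cast norm_ne_zero_iff.mpr (sub_ne_zero.mpr hx)
  have hπ : (π : ℂ) ≠ 0 := by exact_mod_cast Real.pi_ne_zero
  have hexp (r : ℝ) : HasDerivAt (fun r : ℝ => Complex.exp (Complex.I * k * r))
      (Complex.exp (Complex.I * k * r) * (Complex.I * k)) r := by
    simpa using ((Complex.ofRealCLM.hasDerivAt (x := r)).const_mul (Complex.I * (k : ℂ))).cexp
  have hden (r : ℝ) : HasDerivAt (fun r : ℝ => 4 * (π : ℂ) * r) (4 * (π : ℂ)) r := by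
    simpa using (Complex.ofRealCLM.hasDerivAt (x := r)).const_mul (4 * (π : ℂ))
  have hf (r : ℝ) (hr : 0 < r) :
      HasDerivAt (fun r : ℝ => Complex.exp (Complex.I * k * r) / (4 * (π : ℂ) * r))
        (Complex.exp (Complex.I * k * r) * (Complex.I * k * r - 1) / (4 * (π : ℂ) * r * r)) r := by
    have hr' : (r : ℂ) ≠ 0 := by exact_mod_cast hr.ne'
    refine ((hexp r).div (hden r) (by simp [hπ, hr'])).congr_deriv ?_
    field_simp
  have hlin : HasDerivAt (fun r : ℝ => Complex.I * k * (r : ℂ) - 1) (Complex.I * k) ‖x - y‖ := by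
    simpa using
      ((Complex.ofRealCLM.hasDerivAt (x := ‖x - y‖)).const_mul (Complex.I * (k : ℂ))).sub_const 1
  have hid : HasDerivAt (fun r : ℝ => (r : ℂ)) 1 ‖x - y‖ := by
    simpa using (hasDerivAt_id ‖x - y‖).ofReal_comp
  have hf' := ((hexp ‖x - y‖).mul hlin).div ((hden ‖x - y‖).mul hid) (by simp [hπ, hne])
  rw [funext hu, laplacian_comp_norm_sub hx hf hf']
  simp only [Pi.mul_apply]
  field_simp
  ring_nf
  simp only [Complex.I_sq]
  ring
end

section
/- Let k ∈ ℝ, y ∈ EuclideanSpace ℝ (Fin 3), and ν ∈ EuclideanSpace ℝ (Fin 3), and define u : EuclideanSpace ℝ (Fin 3) → ℂ by u(x) = ⟪ν, y − x⟫ · (i k ‖x − y‖ − 1) · exp(i k ‖x − y‖) / (4π ‖x − y‖³); this is the double-layer kernel ν · ∇_y G_k(x) obtained by differentiating the Green's function in the source variable in the direction ν. Then for every x ≠ y, the Helmholtz equation holds: Δu(x) + k² u(x) = 0. -/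
open Real Filter
open scoped RealInnerProductSpace

/-- The derivative of the distance to `y` away from `y`. -/
lemma hasFDerivAt_norm_sub_of_ne {E : Type*} [NormedAddCommGroup E] [InnerProductSpace ℝ E]
    {x y : E} (hxy : x ≠ y) :
    HasFDerivAt (fun z => ‖z - y‖) (‖x - y‖⁻¹ • innerSL ℝ (x - y)) x := by
  have hr : ‖x - y‖ ≠ 0 := norm_ne_zero_iff.2 (sub_ne_zero.2 hxy)
  have h := (((hasFDerivAt_id (𝕜 := ℝ) x).sub_const y).norm_sq).sqrt (by simpa using hr)
  simp only [id, Real.sqrt_sq (norm_nonneg _)] at h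
  refine h.congr_fderiv ?_
  ext v
  simp
  field_simp

/-- Chain rule for a radial function whose profile has derivative `r * c`. -/
lemma hasFDerivAt_radial {E : Type*} [NormedAddCommGroup E] [InnerProductSpace ℝ E]
    {x y : E} (hxy : x ≠ y) {f : ℝ → ℂ} {c : ℂ}
    (hf : HasDerivAt f ((‖x - y‖ : ℂ) * c) ‖x - y‖) :
    HasFDerivAt (fun z => f ‖z - y‖) ((innerSL ℝ (x - y)).smulRight c) x := by
  have hr : (‖x - y‖ : ℂ) ≠ 0 := by simpa [sub_eq_zero] using hxy
  refine (hf.hasFDerivAt.comp x (hasFDerivAt_norm_sub_of_ne hxy)).congr_fderiv ?_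
  ext v
  simp
  field_simp

lemma hasFDerivAt_ofReal_inner_sub {E : Type*} [NormedAddCommGroup E] [InnerProductSpace ℝ E]
    (a x y : E) :
    HasFDerivAt (fun z => ((⟪a, z - y⟫ : ℝ) : ℂ)) (Complex.ofRealCLM.comp (innerSL ℝ a)) x :=
  (Complex.ofRealCLM.comp (innerSL ℝ a)).hasFDerivAt.comp x ((hasFDerivAt_id x).sub_const y)

/-- The Laplacian of a linear function times a radial function. -/
lemma laplacian_inner_mul_radial {x y : EuclideanSpace ℝ (Fin 3)} (hxy : x ≠ y)
    (ν : EuclideanSpace ℝ (Fin 3)) {f g h : ℝ → ℂ}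
    (hf : ∀ r : ℝ, 0 < r → HasDerivAt f (r * g r) r)
    (hg : ∀ r : ℝ, 0 < r → HasDerivAt g (r * h r) r) :
    laplacian (fun z => ((⟪ν, z - y⟫ : ℝ) : ℂ) * f ‖z - y‖) x =
      ((⟪ν, x - y⟫ : ℝ) : ℂ) * (5 * g ‖x - y‖ + (‖x - y‖ : ℂ) ^ 2 * h ‖x - y‖) := by
  have hpos : ∀ z, z ≠ y → 0 < ‖z - y‖ := fun z hz => norm_pos_iff.2 (sub_ne_zero.2 hz)
  have first (e z : EuclideanSpace ℝ (Fin 3)) (hz : z ≠ y) :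
      fderiv ℝ (fun z => ((⟪ν, z - y⟫ : ℝ) : ℂ) * f ‖z - y‖) z e =
        ((⟪ν, e⟫ : ℝ) : ℂ) * f ‖z - y‖ +
          ((⟪ν, z - y⟫ : ℝ) : ℂ) * (((⟪e, z - y⟫ : ℝ) : ℂ) * g ‖z - y‖) := by
    rw [((hasFDerivAt_ofReal_inner_sub ν z y).fun_mul
      (hasFDerivAt_radial hz (hf _ (hpos z hz)))).fderiv]
    simp [-map_sub, real_inner_comm e]
    ring
  have second (e : EuclideanSpace ℝ (Fin 3)) :
      fderiv ℝ (fun z => fderiv ℝ (fun z => ((⟪ν, z - y⟫ : ℝ) : ℂ) * f ‖z - y‖) z e) x e =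
        2 * ((⟪ν, e⟫ : ℝ) : ℂ) * ((⟪e, x - y⟫ : ℝ) : ℂ) * g ‖x - y‖ +
          ((⟪ν, x - y⟫ : ℝ) : ℂ) * (((⟪e, e⟫ : ℝ) : ℂ) * g ‖x - y‖ +
            ((⟪e, x - y⟫ : ℝ) : ℂ) ^ 2 * h ‖x - y‖) := by
    rw [Filter.EventuallyEq.fderiv_eq ((eventually_ne_nhds hxy).mono (first e)),
      (((hasFDerivAt_radial hxy (hf _ (hpos x hxy))).const_mul _).fun_add
        ((hasFDerivAt_ofReal_inner_sub ν x y).fun_mul ((hasFDerivAt_ofReal_inner_sub e x y).fun_mul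
          (hasFDerivAt_radial hxy (hg _ (hpos x hxy)))))).fderiv]
    simp [-map_sub, -inner_self_eq_norm_sq_to_K, real_inner_comm e]
    ring
  have hν : (⟪ν, x - y⟫ : ℝ) = ∑ i, ν i * (x - y) i := by
    simp [PiLp.inner_apply, mul_comm]
  have hr : (‖x - y‖ : ℂ) ^ 2 = ((∑ i, (x - y) i ^ 2 : ℝ) : ℂ) := by
    rw [← EuclideanSpace.real_norm_sq_eq]
    push_cast
    rfl
  simp only [laplacian, second, hr, EuclideanSpace.inner_single_left,
    EuclideanSpace.inner_single_right, hν, Fin.sum_univ_three]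
  simp
  ring

/-- The derivative of `p(r) exp(ikr) / (4π rⁿ)`. -/
lemma hasDerivAt_mul_cexp_div_pow (k : ℝ) {p : ℝ → ℂ} {p' : ℂ} (n : ℕ) {r : ℝ}
    (hr : 0 < r) (hp : HasDerivAt p p' r) :
    HasDerivAt (fun r : ℝ => p r * Complex.exp (Complex.I * k * r) / (4 * (π : ℂ) * (r : ℂ) ^ n))
      ((p' + Complex.I * k * p r - n * p r / r) * Complex.exp (Complex.I * k * r) /
        (4 * (π : ℂ) * (r : ℂ) ^ n)) r := by
  have hrc : (r : ℂ) ≠ 0 := by exact_mod_cast hr.ne'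
  have hπ : (π : ℂ) ≠ 0 := by exact_mod_cast Real.pi_ne_zero
  have hid : HasDerivAt (fun r : ℝ => (r : ℂ)) 1 r := Complex.ofRealCLM.hasDerivAt
  have hden : 4 * (π : ℂ) * (r : ℂ) ^ n ≠ 0 := by simp [hrc, hπ]
  refine ((hp.mul (hid.const_mul (Complex.I * k)).cexp).div
    ((hid.pow n).const_mul (4 * (π : ℂ))) hden).congr_deriv ?_
  rcases n with _ | n
  · simp
    field_simp
  · simp only [Pi.pow_apply, Pi.mul_apply, Nat.add_sub_cancel]
    field_simp
    ring

/-- The double-layer kernel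
`ν · ∇_y G_k(x) = ⟪ν, y − x⟫ (i k ‖x − y‖ − 1) exp(i k ‖x − y‖)/(4π ‖x − y‖³)`,
obtained by differentiating the Helmholtz Green's function in the source variable
in the direction `ν`, satisfies the Helmholtz equation `Δu + k²u = 0` away from
the source `y`. -/
theorem helmholtz_double_layer_kernel_satisfies_helmholtz
    (k : ℝ) (y ν : EuclideanSpace ℝ (Fin 3))
    (u : EuclideanSpace ℝ (Fin 3) → ℂ)
    (hu : ∀ x, u x =
      ((⟪ν, y - x⟫ : ℝ) : ℂ) * (Complex.I * (k : ℂ) * (‖x - y‖ : ℂ) - 1) *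
        Complex.exp (Complex.I * (k : ℂ) * (‖x - y‖ : ℂ)) /
          (4 * (π : ℂ) * (‖x - y‖ : ℂ) ^ 3)) :
    ∀ x, x ≠ y → laplacian u x + (k : ℂ) ^ 2 * u x = 0 := by
  intro x hxy
  have hid (r : ℝ) : HasDerivAt (fun r : ℝ => (r : ℂ)) 1 r := Complex.ofRealCLM.hasDerivAt
  let p : ℝ → ℂ := fun r => 1 - Complex.I * k * r
  let q : ℝ → ℂ := fun r => (k : ℂ) ^ 2 * r ^ 2 + 3 * Complex.I * k * r - 3
  let s : ℝ → ℂ := fun r => (Complex.I * (k : ℂ) ^ 3 * r - (k : ℂ) ^ 2) * r ^ 2 - 5 * q r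
  let F (p : ℝ → ℂ) (n : ℕ) (r : ℝ) : ℂ :=
    p r * Complex.exp (Complex.I * k * r) / (4 * (π : ℂ) * (r : ℂ) ^ n)
  have hf (r : ℝ) (hr : 0 < r) : HasDerivAt (F p 3) (r * F q 5 r) r := by
    have hrc : (r : ℂ) ≠ 0 := by exact_mod_cast hr.ne'
    refine (hasDerivAt_mul_cexp_div_pow k 3 hr
      (((hid r).const_mul (Complex.I * k)).const_sub 1)).congr_deriv ?_
    simp only [F, q]
    field_simp
    ring_nf
    simp only [Complex.I_sq]
    ring
  have hg (r : ℝ) (hr : 0 < r) : HasDerivAt (F q 5) (r * F s 7 r) r := by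
    have hrc : (r : ℂ) ≠ 0 := by exact_mod_cast hr.ne'
    refine (hasDerivAt_mul_cexp_div_pow k 5 hr
      (((((hid r).pow 2).const_mul ((k : ℂ) ^ 2)).add
        ((hid r).const_mul (3 * Complex.I * k))).sub_const 3)).congr_deriv ?_
    simp only [F, s, q, Pi.pow_apply, Pi.add_apply]
    field_simp
    ring_nf
    simp only [Complex.I_sq]
    ring
  have hu' : u = fun z => ((⟪ν, z - y⟫ : ℝ) : ℂ) * F p 3 ‖z - y‖ := by
    funext z
    rw [hu z, ← neg_sub z y, inner_neg_right]
    simp only [F, p]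
    push_cast
    ring
  have hr : (‖x - y‖ : ℂ) ≠ 0 := by simpa [sub_eq_zero] using hxy
  rw [hu', laplacian_inner_mul_radial hxy ν hf hg]
  simp only [F, p, q, s]
  field_simp
  ring
end

section
/- Let k ∈ ℝ and y ∈ EuclideanSpace ℝ (Fin 3), and let u(x) = exp(i k ‖x − y‖) / (4π ‖x − y‖) be the Helmholtz Green's function with source y. Then u satisfies the Sommerfeld radiation condition: the function x ↦ ‖x‖ · ( (fderiv ℝ u x) (‖x‖⁻¹ • x) − i k u(x) ) tends to 0 as ‖x‖ → ∞ (i.e. along the cocompact filter on EuclideanSpace ℝ (Fin 3)). -/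
open Real Filter
open scoped RealInnerProductSpace

section

variable {E : Type*} [NormedAddCommGroup E] [InnerProductSpace ℝ E]

theorem hasFDerivAt_norm_of_ne_zero {x : E} (hx : x ≠ 0) :
    HasFDerivAt (fun z : E => ‖z‖) (‖x‖⁻¹ • innerSL ℝ x) x := by
  have hn : ‖x‖ ≠ 0 := norm_ne_zero_iff.2 hx
  have h := (hasStrictFDerivAt_norm_sq x).hasFDerivAt.sqrt (pow_ne_zero 2 hn)
  simp only [Real.sqrt_sq (norm_nonneg _)] at h
  convert! h using 1
  ext v
  simp
  field_simp

/-- The defect between the inner product and the product of the norms of two vectors is controlled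
by their distance alone. -/
theorem norm_mul_norm_sub_inner_le (a b : E) :
    ‖a‖ * ‖b‖ - inner ℝ a b ≤ ‖a - b‖ ^ 2 / 2 := by
  have h := norm_sub_sq_real a b
  nlinarith [sq_nonneg (‖a‖ - ‖b‖)]

/-- The profile of an outgoing spherical wave with wave number `k`. -/
noncomputable def sphericalWave (k t : ℝ) : ℂ :=
  Complex.exp (Complex.I * (k : ℂ) * (t : ℂ)) / (4 * (π : ℂ) * (t : ℂ))

theorem norm_sphericalWave_le (k : ℝ) {t : ℝ} (ht : 0 < t) : ‖sphericalWave k t‖ ≤ t⁻¹ := by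
  have hexp : ‖Complex.exp (Complex.I * (k : ℂ) * (t : ℂ))‖ = 1 := by
    rw [Complex.norm_exp]
    simp
  have hden : ‖4 * (π : ℂ) * (t : ℂ)‖ = 4 * π * t := by
    simp [abs_of_pos Real.pi_pos, abs_of_pos ht]
  rw [sphericalWave, norm_div, hexp, hden, one_div]
  gcongr
  nlinarith [Real.pi_gt_three]

theorem hasDerivAt_sphericalWave (k : ℝ) {t : ℝ} (ht : t ≠ 0) :
    HasDerivAt (sphericalWave k)
      (sphericalWave k t * (Complex.I * (k : ℂ) - (t : ℂ)⁻¹)) t := by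
  have hpi : (π : ℂ) ≠ 0 := Complex.ofReal_ne_zero.2 Real.pi_ne_zero
  have htc : (t : ℂ) ≠ 0 := Complex.ofReal_ne_zero.2 ht
  have hid : HasDerivAt (fun s : ℝ => (s : ℂ)) 1 t := Complex.ofRealCLM.hasDerivAt
  convert! (hid.const_mul (Complex.I * (k : ℂ))).cexp.div (hid.const_mul (4 * (π : ℂ)))
    (mul_ne_zero (mul_ne_zero (by norm_num) hpi) htc) using 1
  rw [sphericalWave]
  field_simp

theorem fderiv_sphericalWave_norm_sub_apply (k : ℝ) {x y : E} (hxy : x ≠ y) (v : E) :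
    fderiv ℝ (fun z => sphericalWave k ‖z - y‖) x v =
      ((‖x - y‖⁻¹ * inner ℝ (x - y) v : ℝ) : ℂ) *
        (sphericalWave k ‖x - y‖ * (Complex.I * (k : ℂ) - (‖x - y‖ : ℂ)⁻¹)) := by
  have hne : x - y ≠ 0 := sub_ne_zero.2 hxy
  have hnorm : HasFDerivAt (fun z : E => ‖z - y‖) (‖x - y‖⁻¹ • innerSL ℝ (x - y)) x :=
    (hasFDerivAt_comp_sub (f := fun z : E => ‖z‖) y).2 (hasFDerivAt_norm_of_ne_zero hne)
  have h := (hasDerivAt_sphericalWave k (norm_ne_zero_iff.2 hne)).hasFDerivAt.comp x hnorm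
  rw [show (fun z => sphericalWave k ‖z - y‖) = sphericalWave k ∘ fun z => ‖z - y‖ from rfl,
    h.fderiv]
  simp [inner_sub_left]
  ring

theorem norm_sommerfeld_sphericalWave_le (k : ℝ) {x y : E} (hx : x ≠ 0) (hxy : x ≠ y) :
    ‖(‖x‖ : ℂ) * (fderiv ℝ (fun z => sphericalWave k ‖z - y‖) x (‖x‖⁻¹ • x) -
        Complex.I * (k : ℂ) * sphericalWave k ‖x - y‖)‖ ≤
      (|k| * (‖y‖ ^ 2 / 2) + ‖y‖) * (‖x - y‖⁻¹ * ‖x - y‖⁻¹) + ‖x - y‖⁻¹ := by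
  have hr : 0 < ‖x‖ := norm_pos_iff.2 hx
  have hs : 0 < ‖x - y‖ := norm_pos_iff.2 (sub_ne_zero.2 hxy)
  have htri : ‖x‖ ≤ ‖x - y‖ + ‖y‖ := by simpa using norm_add_le (x - y) y
  have hdefect : ‖x - y‖ * ‖x‖ - inner ℝ (x - y) x ≤ ‖y‖ ^ 2 / 2 := by
    simpa using norm_mul_norm_sub_inner_le (x - y) x
  have hcs : |inner ℝ (x - y) x| ≤ ‖x - y‖ * ‖x‖ := abs_real_inner_le_norm _ _
  rw [fderiv_sphericalWave_norm_sub_apply k hxy, inner_smul_right]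
  set s := ‖x - y‖
  set r := ‖x‖
  set p : ℝ := inner ℝ (x - y) x
  have hsc : (s : ℂ) ≠ 0 := Complex.ofReal_ne_zero.2 hs.ne'
  have hrc : (r : ℂ) ≠ 0 := Complex.ofReal_ne_zero.2 hr.ne'
  have hsplit : (r : ℂ) * (((s⁻¹ * (r⁻¹ * p) : ℝ) : ℂ) *
        (sphericalWave k s * (Complex.I * (k : ℂ) - (s : ℂ)⁻¹)) -
          Complex.I * (k : ℂ) * sphericalWave k s) =
      -(sphericalWave k s * (Complex.I * (k : ℂ) * (((s * r - p) * s⁻¹ : ℝ) : ℂ) +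
        ((p * s⁻¹ * s⁻¹ : ℝ) : ℂ))) := by
    push_cast
    field_simp
    ring
  have hfst : ‖Complex.I * (k : ℂ) * (((s * r - p) * s⁻¹ : ℝ) : ℂ)‖ ≤
      |k| * ((‖y‖ ^ 2 / 2) * s⁻¹) := by
    rw [norm_mul, norm_mul, Complex.norm_I, one_mul, Complex.norm_real, Complex.norm_real,
      Real.norm_eq_abs, Real.norm_eq_abs,
      abs_of_nonneg (mul_nonneg (sub_nonneg.2 (le_of_abs_le hcs)) (inv_nonneg.2 hs.le))]
    gcongr
  have hsnd : ‖((p * s⁻¹ * s⁻¹ : ℝ) : ℂ)‖ ≤ (s + ‖y‖) * s⁻¹ := by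
    rw [Complex.norm_real, Real.norm_eq_abs, abs_mul, abs_mul, abs_of_pos (inv_pos.2 hs)]
    gcongr
    rw [← div_eq_mul_inv, div_le_iff₀ hs]
    nlinarith
  rw [hsplit, norm_neg, norm_mul]
  calc _ ≤ s⁻¹ * (|k| * ((‖y‖ ^ 2 / 2) * s⁻¹) + (s + ‖y‖) * s⁻¹) := by
        gcongr
        · exact norm_sphericalWave_le k hs
        · exact (norm_add_le _ _).trans (add_le_add hfst hsnd)
    _ = _ := by
        field_simp
        ring

end

/-- The Helmholtz Green's function
`u(x) = exp(i k ‖x − y‖)/(4π ‖x − y‖)` satisfies the Sommerfeld radiation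
condition: `‖x‖ (∂u/∂r − i k u) → 0` as `‖x‖ → ∞` (along the cocompact filter),
where the radial derivative is `(fderiv ℝ u x) (‖x‖⁻¹ • x)`. -/
theorem helmholtz_green_function_sommerfeld_radiation
    (k : ℝ) (y : EuclideanSpace ℝ (Fin 3))
    (u : EuclideanSpace ℝ (Fin 3) → ℂ)
    (hu : ∀ x, u x =
      Complex.exp (Complex.I * (k : ℂ) * (‖x - y‖ : ℂ)) / (4 * (π : ℂ) * (‖x - y‖ : ℂ))) :
    Tendsto
      (fun x : EuclideanSpace ℝ (Fin 3) =>
        (‖x‖ : ℂ) * ((fderiv ℝ u x) (‖x‖⁻¹ • x) - Complex.I * (k : ℂ) * u x))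
      (cocompact (EuclideanSpace ℝ (Fin 3))) (nhds 0) := by
  obtain rfl : u = fun x => sphericalWave k ‖x - y‖ := funext hu
  have hs : Tendsto (fun x : EuclideanSpace ℝ (Fin 3) => ‖x - y‖)
      (cocompact (EuclideanSpace ℝ (Fin 3))) atTop :=
    tendsto_norm_cocompact_atTop.comp (Homeomorph.subRight y).isClosedEmbedding.tendsto_cocompact
  have hinv := tendsto_inv_atTop_zero.comp hs
  have hbound : Tendsto (fun x : EuclideanSpace ℝ (Fin 3) =>
      (|k| * (‖y‖ ^ 2 / 2) + ‖y‖) * (‖x - y‖⁻¹ * ‖x - y‖⁻¹) + ‖x - y‖⁻¹)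
      (cocompact (EuclideanSpace ℝ (Fin 3))) (nhds 0) := by
    simpa using ((hinv.mul hinv).const_mul (|k| * (‖y‖ ^ 2 / 2) + ‖y‖)).add hinv
  refine squeeze_zero_norm' ?_ hbound
  filter_upwards [tendsto_norm_cocompact_atTop.eventually_gt_atTop 0,
    hs.eventually_gt_atTop 0] with x hx hxy
  exact norm_sommerfeld_sphericalWave_le k (norm_pos_iff.1 hx) (sub_ne_zero.1 (norm_pos_iff.1 hxy))
end
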